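/- Let M = (M,<,…) be a structure expanding a dense linear order without endpoints that is downward o-minimal, let D ⊆ M be a definable discrete set, let a ∈ M, and let n ≥ 1. Then for every definable function F : ((-∞,a))ⁿ → D, the range of F is bounded above in M. -/

import Mathlib

open FirstOrder FirstOrder.Language

universe u v w x

/-- A subset of a linear order is an open interval (possibly unbounded). -/
def IsOpenIntervalSet {M : Type w} [LinearOrder M] (s : Set M) : Prop :=
  (∃ a b : M, s = Set.Ioo a b) ∨ (∃ a : M, s = Set.Ioi a) ∨ (∃ b : M, s = Set.Iio b) ∨
    s = Set.univ

/-- `s` is a finite union of points and open intervals. -/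
def IsFinUnionPointsIntervals {M : Type w} [LinearOrder M] (s : Set M) : Prop :=
  ∃ (F : Finset M) (n : ℕ) (J : Fin n → Set M),
    (∀ k, IsOpenIntervalSet (J k)) ∧ s = ↑F ∪ ⋃ k, J k

/-- `M` is o-minimal: every subset of `M` definable with parameters is a finite union of
points and open intervals. -/
def IsOMinimal (L : FirstOrder.Language.{u, v}) (M : Type w) [L.Structure M]
    [LinearOrder M] : Prop :=
  ∀ s : Set M, (Set.univ : Set M).Definable₁ L s → IsFinUnionPointsIntervals s

/-- `M` is almost o-minimal: every bounded definable (with parameters) subset of `M` is a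
finite union of points and open intervals. -/
def IsAlmostOMinimal (L : FirstOrder.Language.{u, v}) (M : Type w) [L.Structure M]
    [LinearOrder M] : Prop :=
  ∀ s : Set M, (Set.univ : Set M).Definable₁ L s → BddAbove s → BddBelow s →
    IsFinUnionPointsIntervals s

/-- `M` is downward o-minimal: every definable (with parameters) subset of `M` that is
bounded above is a finite union of points and open intervals. -/
def IsDownwardOMinimal (L : FirstOrder.Language.{u, v}) (M : Type w) [L.Structure M]
    [LinearOrder M] : Prop :=
  ∀ s : Set M, (Set.univ : Set M).Definable₁ L s → BddAbove s → IsFinUnionPointsIntervals s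

/-- `M` is upward o-minimal: every definable (with parameters) subset of `M` that is
bounded below is a finite union of points and open intervals. -/
def IsUpwardOMinimal (L : FirstOrder.Language.{u, v}) (M : Type w) [L.Structure M]
    [LinearOrder M] : Prop :=
  ∀ s : Set M, (Set.univ : Set M).Definable₁ L s → BddBelow s → IsFinUnionPointsIntervals s

/-- A subset `D` of a linear order is discrete if every point of `D` has an open interval
around it containing no other point of `D`. -/
def IsDiscreteSet {M : Type w} [LinearOrder M] (D : Set M) : Prop :=
  ∀ x ∈ D, ∃ l r : M, l < x ∧ x < r ∧ ∀ z ∈ D, z ∈ Set.Ioo l r → z = x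

section DefinablePredicates

variable {L : FirstOrder.Language.{u, v}} {M : Type w} [L.Structure M] {α : Type x}

/-- A predicate on tuples is definable with parameters. -/
def DefinablePred (L : FirstOrder.Language.{u, v}) {M : Type w} [L.Structure M] {α : Type x}
    (p : (α → M) → Prop) : Prop :=
  (Set.univ : Set M).Definable L {v | p v}

/-- A binary relation on `M` is definable with parameters. -/
def DefinableRel (L : FirstOrder.Language.{u, v}) {M : Type w} [L.Structure M]
    (R : M → M → Prop) : Prop :=
  DefinablePred L fun v : Fin 2 → M => R (v 0) (v 1)

theorem DefinablePred.and {p q : (α → M) → Prop} (hp : DefinablePred L p)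
    (hq : DefinablePred L q) : DefinablePred L fun v => p v ∧ q v :=
  Set.Definable.inter hp hq

theorem DefinablePred.or {p q : (α → M) → Prop} (hp : DefinablePred L p)
    (hq : DefinablePred L q) : DefinablePred L fun v => p v ∨ q v :=
  Set.Definable.union hp hq

theorem DefinablePred.not {p : (α → M) → Prop} (hp : DefinablePred L p) :
    DefinablePred L fun v => ¬ p v :=
  Set.Definable.compl hp

theorem DefinablePred.imp {p q : (α → M) → Prop} (hp : DefinablePred L p)
    (hq : DefinablePred L q) : DefinablePred L fun v => p v → q v := by
  simpa only [imp_iff_not_or] using hp.not.or hq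

theorem DefinablePred.exists {q : (α → M) → M → Prop}
    (hq : DefinablePred L fun w : α ⊕ Unit → M => q (fun i => w (Sum.inl i)) (w (Sum.inr ()))) :
    DefinablePred L fun v => ∃ y, q v y := by
  have h := Set.Definable.exists_of_finite hq
  have e : {v : α → M | ∃ y, q v y} = {v : α → M | ∃ u : Unit → M, Sum.elim v u ∈
      {w : α ⊕ Unit → M | q (fun i => w (Sum.inl i)) (w (Sum.inr ()))}} := by
    ext v
    exact ⟨fun ⟨y, hy⟩ => ⟨fun _ => y, hy⟩, fun ⟨u, hu⟩ => ⟨u (), hu⟩⟩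
  unfold DefinablePred
  rw [e]
  exact h

theorem DefinablePred.forall {q : (α → M) → M → Prop}
    (hq : DefinablePred L fun w : α ⊕ Unit → M => q (fun i => w (Sum.inl i)) (w (Sum.inr ()))) :
    DefinablePred L fun v => ∀ y, q v y := by
  have h := (DefinablePred.exists (q := fun v y => ¬ q v y) hq.not).not
  simpa only [not_exists, not_not] using h

theorem DefinableRel.comp {R : M → M → Prop} (hR : DefinableRel L R) {f g : (α → M) → M}
    (hf : (Set.univ : Set M).DefinableFun L f) (hg : (Set.univ : Set M).DefinableFun L g) :
    DefinablePred L fun v => R (f v) (g v) := by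
  have hF : (Set.univ : Set M).DefinableMap L (fun v => ![f v, g v]) := by
    simp [Set.DefinableMap, *]
  exact Set.Definable.preimage_map hF hR

theorem definableFun_const_univ (c : M) :
    (Set.univ : Set M).DefinableFun L fun _ : α → M => c :=
  L.definableFun_const α (Set.mem_univ c)

theorem definableRel_eq : DefinableRel L fun x y : M => x = y :=
  Set.Definable.diagonal L _

theorem definableRel_lt [L.IsOrdered] [LinearOrder M] [L.OrderedStructure M] :
    DefinableRel L fun x y : M => x < y := by
  have h : (∅ : Set M).Definable L {v : Fin 2 → M | v 0 < v 1} := by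
    rw [Set.empty_definable_iff]
    refine ⟨Term.lt (n := 0) (Term.var (Sum.inl 0)) (Term.var (Sum.inl 1)), ?_⟩
    ext v
    simp [Formula.Realize]
  exact h.mono (Set.empty_subset _)

end DefinablePredicates

section FinUnion

variable {M : Type w} [LinearOrder M] {s : Set M}

theorem IsFinUnionPointsIntervals.exists_Ioo_subset [NoMinOrder M] [NoMaxOrder M]
    (h : IsFinUnionPointsIntervals s) (hs : s.Infinite) :
    ∃ p q, (Set.Ioo p q).Nonempty ∧ Set.Ioo p q ⊆ s := by
  obtain ⟨F, n, J, hJ, rfl⟩ := h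
  by_cases hne : ∃ k, (J k).Nonempty
  · obtain ⟨k, z, hz⟩ := hne
    obtain ⟨c, hc⟩ := exists_lt z
    obtain ⟨d, hd⟩ := exists_gt z
    have hsub : J k ⊆ ↑F ∪ ⋃ k, J k := (Set.subset_iUnion J k).trans Set.subset_union_right
    rcases hJ k with ⟨p, q, e⟩ | ⟨p, e⟩ | ⟨q, e⟩ | e <;> rw [e] at hz hsub
    · exact ⟨p, q, ⟨z, hz⟩, hsub⟩
    · exact ⟨p, d, ⟨z, hz, hd⟩, fun y hy => hsub hy.1⟩
    · exact ⟨c, q, ⟨z, hc, hz⟩, fun y hy => hsub hy.2⟩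
    · exact ⟨c, d, ⟨z, hc, hd⟩, fun y _ => hsub (Set.mem_univ y)⟩
  · simp only [not_exists, Set.not_nonempty_iff_eq_empty] at hne
    simp [hne] at hs

theorem IsOpenIntervalSet.exists_isLUB [DenselyOrdered M] [NoMinOrder M] [NoMaxOrder M]
    (h : IsOpenIntervalSet s) (hne : s.Nonempty) (hb : BddAbove s) : ∃ c, IsLUB s c := by
  rcases h with ⟨p, q, rfl⟩ | ⟨p, rfl⟩ | ⟨q, rfl⟩ | rfl
  · obtain ⟨z, hz⟩ := hne
    exact ⟨q, isLUB_Ioo (hz.1.trans hz.2)⟩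
  · exact absurd hb (not_bddAbove_Ioi p)
  · exact ⟨q, isLUB_Iio⟩
  · obtain ⟨z, -⟩ := hne
    have : Nonempty M := ⟨z⟩
    exact absurd hb not_bddAbove_univ

theorem IsFinUnionPointsIntervals.exists_isLUB [DenselyOrdered M] [NoMinOrder M] [NoMaxOrder M]
    (h : IsFinUnionPointsIntervals s) (hne : s.Nonempty) (hb : BddAbove s) :
    ∃ c, IsLUB s c := by
  obtain ⟨F, n, J, hJ, rfl⟩ := h
  have union : ∀ A B : Set M, (A.Nonempty → ∃ c, IsLUB A c) → (B.Nonempty → ∃ c, IsLUB B c) →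
      (A ∪ B).Nonempty → ∃ c, IsLUB (A ∪ B) c := by
    intro A B hA hB hAB
    rcases A.eq_empty_or_nonempty with rfl | hA'
    · simpa using hB (by simpa using hAB)
    rcases B.eq_empty_or_nonempty with rfl | hB'
    · simpa using hA hA'
    obtain ⟨c, hc⟩ := hA hA'
    obtain ⟨d, hd⟩ := hB hB'
    exact ⟨c ⊔ d, hc.union hd⟩
  have finset : ∀ t : Finset (Fin n), (⋃ k ∈ t, J k).Nonempty → ∃ c, IsLUB (⋃ k ∈ t, J k) c := by
    intro t
    induction t using Finset.induction_on with
    | empty => simp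
    | insert k t _ ih =>
      rw [Finset.set_biUnion_insert]
      exact union _ _ (fun hk => (hJ k).exists_isLUB hk
        (hb.mono ((Set.subset_iUnion J k).trans Set.subset_union_right))) ih
  refine union _ _ (fun hF => ?_) (fun hU => ?_) hne
  · exact ⟨_, F.isGreatest_max' (by simpa using hF) |>.isLUB⟩
  · simpa using finset Finset.univ (by simpa using hU)

theorem finite_inter_Iic_of_isDiscreteSet {L : FirstOrder.Language.{u, v}} [L.IsOrdered]
    [L.Structure M] [L.OrderedStructure M] [DenselyOrdered M] [NoMinOrder M] [NoMaxOrder M]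
    (hdown : IsDownwardOMinimal L M) {D : Set M} (hDdef : (Set.univ : Set M).Definable₁ L D)
    (hDdisc : IsDiscreteSet D) (b : M) : (D ∩ Set.Iic b).Finite := by
  by_contra hinf
  have hdef : DefinablePred L fun v : Fin 1 → M => v 0 ∈ D ∧ ¬ b < v 0 :=
    DefinablePred.and hDdef
      (definableRel_lt.comp (definableFun_const_univ b) (.proj L)).not
  obtain ⟨p, q, ⟨z, hz⟩, hsub⟩ := (hdown (D ∩ Set.Iic b)
    (by simpa [DefinablePred, Set.Definable₁] using hdef)
    ⟨b, fun y hy => hy.2⟩).exists_Ioo_subset hinf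
  obtain ⟨l, r, hl, hr, hiso⟩ := hDdisc z (hsub hz).1
  obtain ⟨y, hzy, hy⟩ := exists_between (lt_min hr hz.2)
  rw [lt_min_iff] at hy
  exact hzy.ne' (hiso y (hsub ⟨hz.1.trans hzy, hy.2⟩).1 ⟨hl.trans hzy, hy.1⟩)

theorem wellFoundedLT_of_finite_inter_Iic {D : Set M} (h : ∀ b, (D ∩ Set.Iic b).Finite) :
    WellFoundedLT D := by
  refine ⟨WellFounded.wellFounded_iff_has_min.2 fun t ⟨b, hb⟩ => ?_⟩
  have hfin : (Subtype.val '' t ∩ Set.Iic (b : M)).Finite :=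
    (h b).subset fun y ⟨⟨z, _, hz⟩, hy⟩ => ⟨hz ▸ z.2, hy⟩
  obtain ⟨m, ⟨⟨m', hm', rfl⟩, hmb⟩, hmin⟩ :=
    Set.exists_min_image _ id hfin ⟨b, ⟨b, hb, rfl⟩, le_refl (b : M)⟩
  refine ⟨m', hm', fun y hy hlt => ?_⟩
  exact (hmin y ⟨⟨y, hy, rfl⟩, (show (y : M) < m' from hlt).le.trans hmb⟩).not_gt hlt

end FinUnion

section Main

variable {L : FirstOrder.Language.{u, v}} {M : Type w} [L.Structure M] {W : Type x}
  [LinearOrder W]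

theorem definableRel_apply_eq {f : M → W} (hf : DefinableRel L fun x y => f x < f y) :
    DefinableRel L fun x y => f x = f y := by
  have h : DefinableRel L fun x y => ¬ f x < f y ∧ ¬ f y < f x :=
    .and (DefinablePred.not hf) (hf.comp (.proj L) (.proj L)).not
  simpa only [not_lt, ← le_antisymm_iff, eq_comm] using h

variable [LinearOrder M]

theorem exists_Ioo_subset_of_definablePred [NoMinOrder M] [NoMaxOrder M]
    (hdown : IsDownwardOMinimal L M) {p : M → Prop}
    (hp : DefinablePred L fun v : Fin 1 → M => p (v 0)) {b : M} (hb : ∀ y, p y → y ≤ b)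
    (hinf : {y | p y}.Infinite) :
    ∃ l r, (Set.Ioo l r).Nonempty ∧ ∀ y ∈ Set.Ioo l r, p y :=
  (hdown {y | p y} hp ⟨b, hb⟩).exists_Ioo_subset hinf

/-- The interval `(r, s)` has its endpoints below `t` and `t` as its `f`-least point, the left
endpoint having the smaller value. -/
def IsLeftChild (f : M → W) (p q t : M) : Prop :=
  ∃ r s, p < r ∧ r < t ∧ t < s ∧ s < q ∧ f r < f s ∧ f s < f t ∧
    ∀ z, r < z → z < s → ¬ f z < f t

theorem definablePred_isLeftChild [L.IsOrdered] [L.OrderedStructure M] {f : M → W}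
    (hf : DefinableRel L fun x y => f x < f y)
    (p q : M) : DefinablePred L fun v : Fin 1 → M => IsLeftChild f p q (v 0) := by
  have hlt := definableRel_lt (L := L) (M := M)
  refine .exists (.exists ?_)
  refine .and (hlt.comp (definableFun_const_univ _) (.proj L)) ?_
  refine .and (hlt.comp (.proj L) (.proj L)) ?_
  refine .and (hlt.comp (.proj L) (.proj L)) ?_
  refine .and (hlt.comp (.proj L) (definableFun_const_univ _)) ?_
  refine .and (hf.comp (.proj L) (.proj L)) ?_
  refine .and (hf.comp (.proj L) (.proj L)) (.forall ?_)
  exact .imp (hlt.comp (.proj L) (.proj L))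
    (.imp (hlt.comp (.proj L) (.proj L)) (hf.comp (.proj L) (.proj L)).not)

/-- `f` is constant on an open interval around `c`. -/
def IsLocallyConstAt (f : M → W) (c : M) : Prop :=
  ∃ l r, l < c ∧ c < r ∧ ∀ z, l < z → z < r → f z = f c

theorem definablePred_isLocallyConstAt [L.IsOrdered] [L.OrderedStructure M] {f : M → W}
    (hf : DefinableRel L fun x y => f x < f y) :
    DefinablePred L fun v : Fin 1 → M => IsLocallyConstAt f (v 0) := by
  have hlt := definableRel_lt (L := L) (M := M)
  refine .exists (.exists ?_)
  refine .and (hlt.comp (.proj L) (.proj L)) (.and (hlt.comp (.proj L) (.proj L)) (.forall ?_))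
  exact .imp (hlt.comp (.proj L) (.proj L)) (.imp (hlt.comp (.proj L) (.proj L))
    ((definableRel_apply_eq hf).comp (.proj L) (.proj L)))

variable [DenselyOrdered M]

theorem exists_argmin_Ioo [WellFoundedLT W] (f : M → W) {p q : M} (h : p < q) :
    ∃ m ∈ Set.Ioo p q, ∀ z ∈ Set.Ioo p q, f m ≤ f z := by
  obtain ⟨_, ⟨m, hm, rfl⟩, hmin⟩ := (wellFounded_lt (α := W)).has_min (f '' Set.Ioo p q)
    ((Set.nonempty_Ioo.2 h).image f)
  exact ⟨m, hm, fun z hz => not_lt.1 (hmin _ ⟨z, hz, rfl⟩)⟩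

theorem exists_isLeftChild [WellFoundedLT W] {f : M → W} {p q c d : M}
    (hinj : Set.InjOn f (Set.Ioo p q)) (hpc : p ≤ c) (hcd : c < d) (hdq : d ≤ q) :
    ∃ t ∈ Set.Ioo c d, IsLeftChild f p q t := by
  obtain ⟨r, hr, hrmin⟩ := exists_argmin_Ioo f hcd
  obtain ⟨s, hs, hsmin⟩ := exists_argmin_Ioo f hr.2
  obtain ⟨t, ht, htmin⟩ := exists_argmin_Ioo f hs.1
  have hs' : s ∈ Set.Ioo c d := ⟨hr.1.trans hs.1, hs.2⟩
  have ht' : t ∈ Set.Ioo r d := ⟨ht.1, ht.2.trans hs.2⟩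
  have mem : ∀ {z}, z ∈ Set.Ioo c d → z ∈ Set.Ioo p q := fun hz =>
    ⟨hpc.trans_lt hz.1, hz.2.trans_le hdq⟩
  refine ⟨t, ⟨hr.1.trans ht.1, ht'.2⟩, r, s, (mem hr).1, ht.1, ht.2, (mem hs').2,
    (hrmin s hs').lt_of_ne fun e => hs.1.ne (hinj (mem hr) (mem hs') e),
    (hsmin t ht').lt_of_ne fun e => ht.2.ne' (hinj (mem hs')
      (mem ⟨hr.1.trans ht.1, ht'.2⟩) e), fun z h₁ h₂ => (htmin z ⟨h₁, h₂⟩).not_gt⟩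

theorem exists_not_isLeftChild [WellFoundedLT W] {f : M → W} {p q c d : M}
    (hinj : Set.InjOn f (Set.Ioo p q)) (hpc : p ≤ c) (hcd : c < d) (hdq : d ≤ q) :
    ∃ t ∈ Set.Ioo c d, ¬ IsLeftChild f p q t := by
  obtain ⟨s, hs, hsmin⟩ := exists_argmin_Ioo f hcd
  obtain ⟨r, hr, hrmin⟩ := exists_argmin_Ioo f hs.1
  obtain ⟨t, ht, htmin⟩ := exists_argmin_Ioo f hr.2
  have hr' : r ∈ Set.Ioo c d := ⟨hr.1, hr.2.trans hs.2⟩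
  have ht' : t ∈ Set.Ioo c s := ⟨hr.1.trans ht.1, ht.2⟩
  have mem : ∀ {z}, z ∈ Set.Ioo c d → z ∈ Set.Ioo p q := fun hz =>
    ⟨hpc.trans_lt hz.1, hz.2.trans_le hdq⟩
  have htcd : t ∈ Set.Ioo c d := ⟨ht'.1, ht.2.trans hs.2⟩
  have hrt : f r < f t :=
    (hrmin t ht').lt_of_ne fun e => ht.1.ne (hinj (mem hr') (mem htcd) e)
  have hsr : f s ≤ f r := hsmin r hr'
  refine ⟨t, htcd, ?_⟩
  rintro ⟨r', s', -, hr't, hts', -, hlt, hst, hmin⟩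
  have e₁ : r' = r := by
    rcases lt_trichotomy r' r with h | h | h
    · exact absurd hrt (hmin r h (ht.1.trans hts'))
    · exact h
    · exact absurd (hlt.trans hst) (htmin r' ⟨h, hr't.trans ht.2⟩).not_gt
  have e₂ : s' = s := by
    rcases lt_trichotomy s' s with h | h | h
    · exact absurd hst (htmin s' ⟨ht.1.trans hts', h⟩).not_gt
    · exact h
    · exact absurd (hsr.trans_lt hrt) (hmin s (hr't.trans ht.2) h)
  subst e₁ e₂
  exact hsr.not_gt hlt

variable [L.IsOrdered] [L.OrderedStructure M] [NoMinOrder M] [NoMaxOrder M]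

/-- A definable prewellordering of a downward o-minimal structure is not injective on any
nonempty interval. -/
theorem not_injOn_Ioo [WellFoundedLT W] (hdown : IsDownwardOMinimal L M) {f : M → W}
    (hf : DefinableRel L fun x y => f x < f y) {p q : M} (hpq : p < q) :
    ¬ Set.InjOn f (Set.Ioo p q) := by
  intro hinj
  have hlt := definableRel_lt (L := L) (M := M)
  have hIoo : DefinablePred L fun v : Fin 1 → M => p < v 0 ∧ v 0 < q :=
    .and (hlt.comp (definableFun_const_univ _) (.proj L))
      (hlt.comp (.proj L) (definableFun_const_univ _))
  have hleft := definablePred_isLeftChild hf p q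
  have key : {y | (p < y ∧ y < q) ∧ IsLeftChild f p q y}.Infinite ∨
      {y | (p < y ∧ y < q) ∧ ¬ IsLeftChild f p q y}.Infinite := by
    rw [← Set.infinite_union]
    refine (Set.Ioo_infinite hpq).mono fun y hy => ?_
    by_cases h : IsLeftChild f p q y
    · exact .inl ⟨hy, h⟩
    · exact .inr ⟨hy, h⟩
  have bounds : ∀ {c d : M}, c < d → (∀ y ∈ Set.Ioo c d, p < y ∧ y < q) → p ≤ c ∧ d ≤ q := by
    intro c d hcd h
    constructor
    · by_contra! hc
      obtain ⟨y, hy, hy'⟩ := exists_between (lt_min hc hcd)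
      rw [lt_min_iff] at hy'
      exact hy'.1.not_gt (h y ⟨hy, hy'.2⟩).1
    · by_contra! hd
      obtain ⟨y, hy', hy⟩ := exists_between (max_lt hd hcd)
      rw [max_lt_iff] at hy'
      exact hy'.1.not_gt (h y ⟨hy'.2, hy⟩).2
  rcases key with hinf | hinf
  · obtain ⟨c, d, ⟨z, hz⟩, hsub⟩ := exists_Ioo_subset_of_definablePred hdown (hIoo.and hleft)
      (b := q) (fun y hy => hy.1.2.le) hinf
    have hcd := hz.1.trans hz.2
    obtain ⟨hc, hd⟩ := bounds hcd fun y hy => (hsub y hy).1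
    obtain ⟨t, ht, hn⟩ := exists_not_isLeftChild hinj hc hcd hd
    exact hn (hsub t ht).2
  · obtain ⟨c, d, ⟨z, hz⟩, hsub⟩ := exists_Ioo_subset_of_definablePred hdown
      (hIoo.and hleft.not) (b := q) (fun y hy => hy.1.2.le) hinf
    have hcd := hz.1.trans hz.2
    obtain ⟨hc, hd⟩ := bounds hcd fun y hy => (hsub y hy).1
    obtain ⟨t, ht, hn⟩ := exists_isLeftChild hinj hc hcd hd
    exact (hsub t ht).2 hn

/-- A definable locally constant map is constant on closed intervals. -/
theorem apply_eq_of_isLocallyConstAt (hdown : IsDownwardOMinimal L M) {f : M → W}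
    (hf : DefinableRel L fun x y => f x < f y) {c d : M} (hcd : c ≤ d)
    (hloc : ∀ z ∈ Set.Icc c d, IsLocallyConstAt f z) : f c = f d := by
  have hlt := definableRel_lt (L := L) (M := M)
  have hdef : DefinablePred L fun v : Fin 1 → M => (¬ v 0 < c ∧ ¬ d < v 0) ∧
      ∀ z, ¬ z < c → ¬ v 0 < z → f z = f c := by
    refine .and (.and (hlt.comp (.proj L) (definableFun_const_univ _)).not
      (hlt.comp (definableFun_const_univ _) (.proj L)).not) (.forall ?_)
    exact .imp (hlt.comp (.proj L) (definableFun_const_univ _)).not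
      (.imp (hlt.comp (.proj L) (.proj L)).not
        ((definableRel_apply_eq hf).comp (.proj L) (definableFun_const_univ _)))
  simp only [not_lt] at hdef
  set K : Set M := {y | (c ≤ y ∧ y ≤ d) ∧ ∀ z, c ≤ z → z ≤ y → f z = f c} with hK
  have hbdd : BddAbove K := ⟨d, fun y hy => hy.1.2⟩
  have hcK : c ∈ K := ⟨⟨le_rfl, hcd⟩, fun z h₁ h₂ => by rw [le_antisymm h₂ h₁]⟩
  obtain ⟨s, hs⟩ := (hdown K hdef hbdd).exists_isLUB ⟨c, hcK⟩ hbdd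
  have hcs : c ≤ s := hs.1 hcK
  have hsd : s ≤ d := hs.2 fun y hy => hy.1.2
  obtain ⟨l, r, hl, hr, hlr⟩ := hloc s ⟨hcs, hsd⟩
  obtain ⟨y, hyK, hly, hys⟩ := hs.exists_between hl
  have hfs : f s = f c := (hlr y hly (hys.trans_lt hr)).symm.trans (hyK.2 y hyK.1.1 le_rfl)
  have ext : ∀ z, c ≤ z → z < r → f z = f c := by
    intro z hcz hzr
    rcases le_total z y with h | h
    · exact hyK.2 z hcz h
    · rcases h.eq_or_lt with rfl | h
      · exact hyK.2 _ hcz le_rfl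
      · exact (hlr z (hly.trans h) hzr).trans hfs
  rcases hsd.eq_or_lt with rfl | hsd
  · exact hfs.symm
  · obtain ⟨t, hst, ht⟩ := exists_between (lt_min hr hsd)
    rw [lt_min_iff] at ht
    exact absurd (hs.1 (show t ∈ K from ⟨⟨hcs.trans hst.le, ht.2.le⟩,
      fun z h₁ h₂ => ext z h₁ (h₂.trans_lt ht.1)⟩)) hst.not_ge

/-- A definable prewellordering has finitely many classes meeting `(-∞, a)`. -/
theorem finite_image_Iio [WellFoundedLT W] (hdown : IsDownwardOMinimal L M) {f : M → W}
    (hf : DefinableRel L fun x y => f x < f y) (a : M) : (f '' Set.Iio a).Finite := by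
  have hlt := definableRel_lt (L := L) (M := M)
  have heq := definableRel_apply_eq hf
  set N : Set M := {y | y < a ∧ ¬ IsLocallyConstAt f y} with hN
  have hNdef : DefinablePred L fun v : Fin 1 → M => v 0 < a ∧ ¬ IsLocallyConstAt f (v 0) :=
    .and (hlt.comp (.proj L) (definableFun_const_univ _)) (definablePred_isLocallyConstAt hf).not
  by_cases hfin : N.Finite
  · have hcover : f '' Set.Iio a ⊆ f '' N ∪ f '' (Set.Iio a \ N) := by
      rw [← Set.image_union]
      exact Set.image_mono fun y hy => by by_cases h : y ∈ N <;> simp_all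
    refine ((hfin.image f).union ?_).subset hcover
    have hconst : ∀ u ∈ Set.Iio a \ N, ∀ t ∈ Set.Iio a \ N, u ≤ t →
        N ∩ Set.Iio u = N ∩ Set.Iio t → f u = f t := by
      intro u hu t ht hut he
      refine apply_eq_of_isLocallyConstAt hdown hf hut fun z hz => ?_
      by_contra hz'
      have hzN : z ∈ N := ⟨hz.2.trans_lt ht.1, hz'⟩
      have hzt : z < t := hz.2.lt_of_ne fun e => ht.2 (e ▸ hzN)
      have : z ∈ N ∩ Set.Iio u := he ▸ ⟨hzN, hzt⟩
      exact hz.1.not_gt this.2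
    have hsubs : ∀ A : Set M, (f '' {u ∈ Set.Iio a \ N | N ∩ Set.Iio u = A}).Subsingleton := by
      rintro A _ ⟨u, hu, rfl⟩ _ ⟨t, ht, rfl⟩
      rcases le_total u t with h | h
      · exact hconst u hu.1 t ht.1 h (hu.2.trans ht.2.symm)
      · exact (hconst t ht.1 u hu.1 h (ht.2.trans hu.2.symm)).symm
    refine (hfin.finite_subsets.biUnion fun A _ => (hsubs A).finite).subset ?_
    rintro _ ⟨u, hu, rfl⟩
    exact Set.mem_biUnion (show N ∩ Set.Iio u ⊆ N from Set.inter_subset_left) ⟨u, ⟨hu, rfl⟩, rfl⟩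
  exfalso
  obtain ⟨p, q, ⟨w, hw⟩, hpqN⟩ := exists_Ioo_subset_of_definablePred hdown hNdef (b := a)
    (fun y hy => hy.1.le) hfin
  have hpq : p < q := hw.1.trans hw.2
  have hfiber : ∀ c, {y | (p < y ∧ y < q) ∧ f y = f c}.Finite := by
    intro c
    by_contra hinf
    have hdef : DefinablePred L fun v : Fin 1 → M => (p < v 0 ∧ v 0 < q) ∧ f (v 0) = f c :=
      .and (.and (hlt.comp (definableFun_const_univ _) (.proj L))
        (hlt.comp (.proj L) (definableFun_const_univ _)))
        (heq.comp (.proj L) (definableFun_const_univ _))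
    obtain ⟨l, r, ⟨z, hz⟩, hsub⟩ := exists_Ioo_subset_of_definablePred hdown hdef (b := q)
      (fun y hy => hy.1.2.le) hinf
    exact (hpqN z (hsub z hz).1).2 ⟨l, r, hz.1, hz.2, fun y h₁ h₂ =>
      (hsub y ⟨h₁, h₂⟩).2.trans (hsub z hz).2.symm⟩
  have hfirst : {y | (p < y ∧ y < q) ∧ ∀ z, p < z → z < y → ¬ f z = f y}.Infinite := by
    intro hfirst
    refine Set.Ioo_infinite hpq ((hfirst.biUnion fun c _ => hfiber c).subset fun y hy => ?_)
    obtain ⟨m, hm, hmin⟩ := Set.exists_min_image _ id (hfiber y) ⟨y, hy, rfl⟩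
    refine Set.mem_biUnion (x := m) ⟨hm.1, fun z hpz hzm e => ?_⟩ ⟨hy, hm.2.symm⟩
    exact (hmin z ⟨⟨hpz, hzm.trans hm.1.2⟩, e.trans hm.2⟩).not_gt hzm
  have hdef : DefinablePred L fun v : Fin 1 → M => (p < v 0 ∧ v 0 < q) ∧
      ∀ z, p < z → z < v 0 → ¬ f z = f (v 0) := by
    refine .and (.and (hlt.comp (definableFun_const_univ _) (.proj L))
      (hlt.comp (.proj L) (definableFun_const_univ _))) (.forall ?_)
    exact .imp (hlt.comp (definableFun_const_univ _) (.proj L))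
      (.imp (hlt.comp (.proj L) (.proj L)) (heq.comp (.proj L) (.proj L)).not)
  obtain ⟨l, r, ⟨z, hz⟩, hsub⟩ := exists_Ioo_subset_of_definablePred hdown hdef (b := q)
    (fun y hy => hy.1.2.le) hfirst
  refine not_injOn_Ioo hdown hf (hz.1.trans hz.2) fun y hy t ht e => ?_
  rcases lt_trichotomy y t with h | h | h
  · exact absurd e ((hsub t ht).2 y (hsub y hy).1.1 h)
  · exact h
  · exact absurd e.symm ((hsub y hy).2 t (hsub t ht).1.1 h)

/-- A definable family of bounded subsets of a definable discrete set, indexed by `(-∞, a)`, has a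
bounded union. -/
theorem bddAbove_iUnion_of_definableRel (hdown : IsDownwardOMinimal L M)
    {D : Set M} (hDdef : (Set.univ : Set M).Definable₁ L D) (hDdisc : IsDiscreteSet D)
    {a : M} {T : M → M → Prop} (hT : DefinableRel L T)
    (hTD : ∀ y d, T y d → y < a ∧ d ∈ D) (hb : ∀ y, BddAbove {d | T y d}) :
    BddAbove {d | ∃ y, T y d} := by
  rcases D.eq_empty_or_nonempty with rfl | ⟨d₀, hd₀⟩
  · exact ⟨a, fun d ⟨y, hy⟩ => absurd (hTD y d hy).2 (Set.notMem_empty d)⟩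
  have hDfin := finite_inter_Iic_of_isDiscreteSet hdown hDdef hDdisc
  have : WellFoundedLT D := wellFoundedLT_of_finite_inter_Iic hDfin
  have hmax : ∀ y, ∃ m : D, IsGreatest {d | T y d ∨ d = d₀} (m : M) := by
    intro y
    have hsub : {d | T y d ∨ d = d₀} ⊆ D := by
      rintro d (h | rfl)
      exacts [(hTD y d h).2, hd₀]
    obtain ⟨b, hb⟩ := hb y
    have hfin : {d | T y d ∨ d = d₀}.Finite := (hDfin (b ⊔ d₀)).subset fun d hd => by
      refine ⟨hsub hd, ?_⟩
      rcases hd with h | rfl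
      exacts [(hb h).trans le_sup_left, le_sup_right]
    obtain ⟨m, hm, hmax⟩ := Set.exists_max_image _ id hfin ⟨d₀, .inr rfl⟩
    exact ⟨⟨m, hsub hm⟩, hm, hmax⟩
  choose f hf using hmax
  have hiff : ∀ x y, f x < f y ↔ ∃ e, (T y e ∨ e = d₀) ∧ ∀ d, (T x d ∨ d = d₀) → d < e := by
    intro x y
    constructor
    · exact fun h => ⟨f y, (hf y).1, fun d hd => ((hf x).2 hd).trans_lt h⟩
    · rintro ⟨e, he, h⟩
      exact Subtype.coe_lt_coe.1 ((h _ (hf x).1).trans_le ((hf y).2 he))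
  have hfdef : DefinableRel L fun x y => f x < f y := by
    simp only [hiff]
    refine .exists (.and (.or (hT.comp (.proj L) (.proj L))
      (definableRel_eq.comp (.proj L) (definableFun_const_univ _))) (.forall ?_))
    exact .imp (.or (hT.comp (.proj L) (.proj L))
      (definableRel_eq.comp (.proj L) (definableFun_const_univ _)))
      (definableRel_lt.comp (.proj L) (.proj L))
  have : Nonempty M := ⟨a⟩
  obtain ⟨b, hb⟩ := ((finite_image_Iio hdown hfdef a).image Subtype.val).bddAbove
  exact ⟨b, fun d ⟨y, hy⟩ => ((hf y).2 (.inl hy)).trans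
    (hb ⟨f y, ⟨y, (hTD y d hy).1, rfl⟩, rfl⟩)⟩

/-- A definable family of bounded subsets of a definable discrete set, indexed by a power of
`(-∞, a)`, has a bounded union. -/
theorem bddAbove_image_last_of_definable (hdown : IsDownwardOMinimal L M)
    {D : Set M} (hDdef : (Set.univ : Set M).Definable₁ L D) (hDdisc : IsDiscreteSet D)
    {a : M} {n : ℕ} {R : Set (Fin (n + 1) → M)} (hR : (Set.univ : Set M).Definable L R)
    (hRD : ∀ v ∈ R, (∀ k : Fin n, v k.castSucc < a) ∧ v (Fin.last n) ∈ D)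
    (hb : ∀ y : Fin n → M, BddAbove {d | Fin.snoc (α := fun _ => M) y d ∈ R}) :
    BddAbove ((fun v => v (Fin.last n)) '' R) := by
  induction n with
  | zero =>
    obtain ⟨b, hb⟩ := hb Fin.elim0
    refine ⟨b, ?_⟩
    rintro _ ⟨v, hv, rfl⟩
    have e : Fin.snoc (α := fun _ => M) Fin.elim0 (v (Fin.last 0)) = v := by
      ext k
      rw [Fin.eq_zero k]
      exact Fin.snoc_last (α := fun _ => M) _ _
    exact hb (show Fin.snoc (α := fun _ => M) Fin.elim0 (v (Fin.last 0)) ∈ R from e ▸ hv)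
  | succ n ih =>
    have hT : DefinableRel L fun y d => ∃ v ∈ R, v 0 = y ∧ v (Fin.last (n + 1)) = d := by
      have h := hR.image_comp ![0, Fin.last (n + 1)]
      unfold DefinableRel DefinablePred
      convert! h using 1
      ext w
      simp only [Set.mem_ofPred_eq, Set.mem_image, funext_iff, Fin.forall_fin_two]
      rfl
    refine (bddAbove_iUnion_of_definableRel hdown hDdef hDdisc (a := a) hT ?_ fun y => ?_).mono ?_
    · rintro y d ⟨v, hv, rfl, rfl⟩
      exact ⟨(hRD v hv).1 0, (hRD v hv).2⟩
    · have hslice : (Set.univ : Set M).Definable L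
          {w : Fin (n + 1) → M | Fin.cons (α := fun _ => M) y w ∈ R} := by
        refine Set.Definable.preimage_map
          (F := fun w : Fin (n + 1) → M => Fin.cons (α := fun _ => M) y w) (fun i => ?_) hR
        refine Fin.cases ?_ (fun i => ?_) i
        · exact definableFun_const_univ y
        · exact .proj L
      refine (ih hslice (fun w hw => ?_) fun z => ?_).mono ?_
      · exact ⟨fun k => by simpa using! (hRD _ hw).1 k.succ, by simpa using! (hRD _ hw).2⟩
      · have := hb (Fin.cons y z)
        simpa only [Set.mem_ofPred_eq, Fin.cons_snoc_eq_snoc_cons] using! this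
      · rintro d ⟨v, hv, rfl, rfl⟩
        exact ⟨Fin.tail v, by simpa [Fin.cons_self_tail] using hv, rfl⟩
    · rintro _ ⟨v, hv, rfl⟩
      exact ⟨v 0, v, hv, rfl, rfl⟩

end Main

/-- Let `M` be a downward o-minimal structure expanding a dense linear
order without endpoints, `D ⊆ M` a definable discrete set, `a ∈ M` and `n ≥ 1`.  Then for
every definable function `F : ((-∞,a))ⁿ → D` (a function whose values on `{y | ∀ k, y k < a}`
lie in `D` and whose graph, with output as the last coordinate, is a definable subset of
`M^(n+1)`), the range of `F` on `((-∞,a))ⁿ` is bounded above in `M`. -/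
theorem range_bddAbove_of_definable_function_into_discrete_downward
    {L : FirstOrder.Language.{u, v}} [L.IsOrdered] {M : Type w}
    [LinearOrder M] [L.Structure M] [L.OrderedStructure M]
    [DenselyOrdered M] [NoMinOrder M] [NoMaxOrder M]
    (hdown : IsDownwardOMinimal L M)
    (D : Set M) (hDdef : (Set.univ : Set M).Definable₁ L D) (hDdisc : IsDiscreteSet D)
    (a : M) (n : ℕ) (hn : 1 ≤ n)
    (F : (Fin n → M) → M)
    (hFD : ∀ y : Fin n → M, (∀ k, y k < a) → F y ∈ D)
    (hFdef : (Set.univ : Set M).Definable L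
      {v : Fin (n + 1) → M | (∀ k : Fin n, v k.castSucc < a) ∧
        v (Fin.last n) = F fun k => v k.castSucc}) :
    BddAbove (F '' {y : Fin n → M | ∀ k, y k < a}) := by
  refine (bddAbove_image_last_of_definable hdown hDdef hDdisc (a := a) hFdef ?_
    fun y => ⟨F y, ?_⟩).mono ?_
  · rintro v ⟨hv, hlast⟩
    exact ⟨hv, hlast ▸ hFD _ hv⟩
  · rintro d ⟨-, hd⟩
    simp only [Fin.snoc_last, Fin.snoc_castSucc] at hd
    exact hd.le
  · rintro _ ⟨y, hy, rfl⟩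
    exact ⟨Fin.snoc y (F y), by simpa using hy, by simp⟩
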